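/- arXiv:2508.17277 — 2 statements merged into one kernel-verified Lean document; each statement's English description precedes it below -/
import Mathlib

section
/- There is an absolute constant c > 0 with the following property: for every positive integer m and every real ε ∈ (0,1), if P is a set of n points in the plane in general position with n ≥ c·m/ε⁴, and P is partitioned into two separated subsets P₁ and P₂ with ||P₁| − |P₂|| ≤ 1, then there exist an m-element subset A ⊆ P₁ and an m-element subset B ⊆ P₂ that form an ε-avoiding pair. -/
open scoped Classical

/-- Points in the plane. -/
abbrev Pt := ℝ × ℝ

/-- A finite planar point set is in general position if no three of its points are collinear. -/
def GenPos (P : Finset Pt) : Prop :=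
  ∀ p ∈ P, ∀ q ∈ P, ∀ r ∈ P, p ≠ q → p ≠ r → q ≠ r → ¬ Collinear ℝ ({p, q, r} : Set Pt)

/-- Two closed segments cross: their intersection is a single point lying in the
relative interior (open segment) of both. -/
def SegCross (s t : Pt × Pt) : Prop :=
  ∃ x : Pt, segment ℝ s.1 s.2 ∩ segment ℝ t.1 t.2 = {x} ∧
    x ∈ openSegment ℝ s.1 s.2 ∧ x ∈ openSegment ℝ t.1 t.2

/-- A crossing family of size `k` in `P`: `k` segments with endpoints in `P`, pairwise crossing. -/
def CrossingFamily (P : Finset Pt) (k : ℕ) : Prop :=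
  ∃ F : Finset (Pt × Pt), F.card = k ∧ (∀ e ∈ F, e.1 ∈ P ∧ e.2 ∈ P) ∧
    ∀ e ∈ F, ∀ f ∈ F, e ≠ f → SegCross e f

/-- A non-crossing family of size `m` in `P`. -/
def NonCrossingFamily (P : Finset Pt) (m : ℕ) : Prop :=
  ∃ P₁ P₂ P₃ P₄ : Finset Pt,
    P₁ ⊆ P ∧ P₂ ⊆ P ∧ P₃ ⊆ P ∧ P₄ ⊆ P ∧
    Disjoint P₁ P₂ ∧ Disjoint P₁ P₃ ∧ Disjoint P₁ P₄ ∧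
    Disjoint P₂ P₃ ∧ Disjoint P₂ P₄ ∧ Disjoint P₃ P₄ ∧
    m ≤ P₁.card ∧ m ≤ P₂.card ∧ m ≤ P₃.card ∧ m ≤ P₄.card ∧
    ∀ p₁ ∈ P₁, ∀ p₂ ∈ P₂, ∀ p₃ ∈ P₃, ∀ p₄ ∈ P₄,
      p₄ ∈ interior (convexHull ℝ ({p₁, p₂, p₃} : Set Pt))

/-- A point set is in convex position if no point lies in the convex hull of the others. -/
def ConvexPos (S : Set Pt) : Prop := ∀ p ∈ S, p ∉ convexHull ℝ (S \ {p})

/-- A convex bundle of size `k` and width `m` in `P`. -/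
def ConvexBundle (P : Finset Pt) (k m : ℕ) : Prop :=
  ∃ C : Fin k → Finset Pt, (∀ i, C i ⊆ P) ∧
    (∀ i j, i ≠ j → Disjoint (C i) (C j)) ∧
    (∀ i, m ≤ (C i).card) ∧
    ∀ f : Fin k → Pt, (∀ i, f i ∈ C i) → ConvexPos (Set.range f)

/-- Two finite point sets are separated if their convex hulls are disjoint. -/
def Separated (A B : Finset Pt) : Prop :=
  Disjoint (convexHull ℝ (A : Set Pt)) (convexHull ℝ (B : Set Pt))

/-- A line in the plane, given by an equation `a * x + b * y = c` with `(a, b) ≠ (0, 0)`. -/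
structure Line where
  a : ℝ
  b : ℝ
  c : ℝ
  nondeg : a ≠ 0 ∨ b ≠ 0

/-- The set of points of a line. -/
def Line.toSet (L : Line) : Set Pt := {x | L.a * x.1 + L.b * x.2 = L.c}

/-- Two lines are parallel if their normal vectors are proportional. -/
def Line.Parallel (L M : Line) : Prop := L.a * M.b - L.b * M.a = 0

/-- A spoke set of size `k` in `P`: `k` pairwise non-parallel lines such that every unbounded
cell of their arrangement (unbounded connected component of the complement of their union)
contains a point of `P`. -/
def SpokeSet (P : Finset Pt) (k : ℕ) : Prop :=
  ∃ ℓ : Fin k → Line,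
    (∀ i j, i ≠ j → ¬ (ℓ i).Parallel (ℓ j)) ∧
    ∀ x : Pt, x ∈ (⋃ i, (ℓ i).toSet)ᶜ →
      ¬ Bornology.IsBounded (connectedComponentIn (⋃ i, (ℓ i).toSet)ᶜ x) →
      ∃ p ∈ P, p ∈ connectedComponentIn (⋃ i, (ℓ i).toSet)ᶜ x

/-- `b` lies strictly to the left of the line through `x` and `y`, oriented from `x` to `y`. -/
def LeftOf (x y b : Pt) : Prop :=
  0 < (y.1 - x.1) * (b.2 - x.2) - (y.2 - x.2) * (b.1 - x.1)

/-- The relation `<_B`: `x <_B y` iff `B` is contained in the open half-plane to the left of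
the line through `x` and `y` oriented from `x` towards `y`. -/
def LtRel (B : Finset Pt) (x y : Pt) : Prop :=
  x ≠ y ∧ ∀ b ∈ B, LeftOf x y b

/-- `x` and `y` are incomparable in `<_B`. -/
def Incomp (B : Finset Pt) (x y : Pt) : Prop := ¬ LtRel B x y ∧ ¬ LtRel B y x

/-- `ι(A, <_B)`: the number of unordered pairs of distinct points of `A`
that are incomparable in `<_B`. -/
noncomputable def iota (A B : Finset Pt) : ℕ :=
  Set.ncard {s : Finset Pt | ∃ x y : Pt, x ≠ y ∧ s = {x, y} ∧ x ∈ A ∧ y ∈ A ∧ Incomp B x y}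

/-- `A` and `B` (two `m`-element sets) form an `ε`-avoiding pair. -/
def EpsAvoiding (ε : ℝ) (m : ℕ) (A B : Finset Pt) : Prop :=
  ((iota A B : ℝ) + (iota B A : ℝ)) ≤ ε * (m : ℝ) ^ 2

/-- The zone of a line `ℓ` in the arrangement of the lines `ℓs`: the union of all cells
(connected components of the complement) whose closure meets `ℓ`. -/
noncomputable def Zone (r : ℕ) (ℓs : Fin r → Line) (ℓ : Line) : Set Pt :=
  {y | ∃ x ∈ (⋃ i, (ℓs i).toSet)ᶜ,
    y ∈ connectedComponentIn (⋃ i, (ℓs i).toSet)ᶜ x ∧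
    (closure (connectedComponentIn (⋃ i, (ℓs i).toSet)ᶜ x) ∩ ℓ.toSet).Nonempty}

/-! ### Helper lemmas -/

/-- Order statistics of finitely many continuous functions are continuous. -/
lemma exists_order_stat (S : Finset Pt) (F : Pt → ℝ → ℝ) (hF : ∀ p, Continuous (F p))
    (K : ℕ) (hK : 1 ≤ K) (hKS : K ≤ S.card) :
    ∃ f : ℝ → ℝ, Continuous f ∧ ∀ s, K ≤ (S.filter (fun p => F p s ≤ f s)).card ∧
      S.card + 1 ≤ (S.filter (fun p => f s ≤ F p s)).card + K := by
  have hne : (S.powersetCard K).attach.Nonempty := by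
    rw [Finset.attach_nonempty_iff]
    exact Finset.powersetCard_nonempty.2 hKS
  have hT : ∀ T : {T // T ∈ S.powersetCard K}, T.1.Nonempty := by
    intro T
    have := (Finset.mem_powersetCard.1 T.2).2
    exact Finset.card_pos.1 (by omega)
  refine ⟨fun s => (S.powersetCard K).attach.inf' hne
    (fun T => T.1.sup' (hT T) (fun p => F p s)), ?_, ?_⟩
  · apply Continuous.finset_inf'_apply
    intro T _
    apply Continuous.finset_sup'_apply
    intro p _
    exact hF p
  · intro s
    constructor
    · obtain ⟨T, -, hTe⟩ := Finset.exists_mem_eq_inf' hne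
        (fun T : {T // T ∈ S.powersetCard K} => T.1.sup' (hT T) (fun p => F p s))
      have hm := Finset.mem_powersetCard.1 T.2
      refine hm.2.symm.le.trans ?_
      apply Finset.card_le_card
      intro p hp
      rw [Finset.mem_filter]
      refine ⟨hm.1 hp, ?_⟩
      simp only
      rw [hTe]
      exact Finset.le_sup' (fun p => F p s) hp
    · set v := (S.powersetCard K).attach.inf' hne
        (fun T => T.1.sup' (hT T) (fun p => F p s)) with hv
      have hlt : (S.filter (fun p => ¬ v ≤ F p s)).card < K := by
        by_contra hcon
        push Not at hcon
        obtain ⟨T, hTs, hTc⟩ := Finset.exists_subset_card_eq hcon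
        have hTm : T ∈ S.powersetCard K :=
          Finset.mem_powersetCard.2 ⟨hTs.trans (Finset.filter_subset _ _), hTc⟩
        have h1 : v ≤ T.sup' (hT ⟨T, hTm⟩) (fun p => F p s) :=
          Finset.inf'_le (fun T : {T // T ∈ S.powersetCard K} =>
            T.1.sup' (hT T) (fun p => F p s)) (Finset.mem_attach _ ⟨T, hTm⟩)
        have h2 : T.sup' (hT ⟨T, hTm⟩) (fun p => F p s) < v := by
          rw [Finset.sup'_lt_iff]
          intro p hp
          simpa using (Finset.mem_filter.1 (hTs hp)).2
        linarith
      have := Finset.card_filter_add_card_filter_not (s := S) (fun p => v ≤ F p s)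
      change S.card + 1 ≤ (S.filter (fun p => v ≤ F p s)).card + K
      omega

/-- A line contains at most two points of a set in general position. -/
lemma card_line_le_two (P S : Finset Pt) (hP : GenPos P) (hS : S ⊆ P) (a b c : ℝ)
    (hab : a ≠ 0 ∨ b ≠ 0) :
    (S.filter (fun p => a * p.1 + b * p.2 + c = 0)).card ≤ 2 := by
  by_contra hcon
  push Not at hcon
  obtain ⟨p, q, r, hp, hq, hr, hpq, hpr, hqr⟩ := Finset.two_lt_card_iff.1 hcon
  simp only [Finset.mem_filter] at hp hq hr
  apply hP p (hS hp.1) q (hS hq.1) r (hS hr.1) hpq hpr hqr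
  have hab2 : 0 < a ^ 2 + b ^ 2 := by
    rcases hab with h | h <;> positivity
  rw [collinear_iff_of_mem (p₀ := p) (by simp)]
  refine ⟨(-b, a), ?_⟩
  have key : ∀ z : Pt, a * z.1 + b * z.2 + c = 0 → ∃ t : ℝ, z = t • ((-b, a) : Pt) +ᵥ p := by
    intro z hz
    refine ⟨(a * (z.2 - p.2) - b * (z.1 - p.1)) / (a ^ 2 + b ^ 2), ?_⟩
    have h0 : a * (z.1 - p.1) + b * (z.2 - p.2) = 0 := by linarith [hp.2]
    ext
    · simp only [Prod.smul_mk, vadd_eq_add, smul_eq_mul, Prod.fst_add]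
      field_simp
      linear_combination a * h0
    · simp only [Prod.smul_mk, vadd_eq_add, smul_eq_mul, Prod.snd_add]
      field_simp
      linear_combination b * h0
  intro z hz
  simp only [Set.mem_insert_iff, Set.mem_singleton_iff] at hz
  rcases hz with rfl | rfl | rfl
  · exact key _ hp.2
  · exact key _ hq.2
  · exact key _ hr.2

/-- Ham sandwich cut for separated sets. -/
lemma ham_sandwich (P L R : Finset Pt) (hP : GenPos P) (hL : L ⊆ P) (hR : R ⊆ P)
    (a b c : ℝ) (hab : a ≠ 0 ∨ b ≠ 0)
    (hLh : ∀ p ∈ L, a * p.1 + b * p.2 + c < 0) (hRh : ∀ p ∈ R, 0 < a * p.1 + b * p.2 + c)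
    (N : ℕ) (hN : 2 ≤ N) (hLN : 2 * N ≤ L.card + 3) (hRN : 2 * N ≤ R.card + 3) :
    ∃ a' b' c' : ℝ, (a' ≠ 0 ∨ b' ≠ 0) ∧
      N ≤ (L.filter (fun p => a' * p.1 + b' * p.2 + c' < 0)).card + 3 ∧
      N ≤ (L.filter (fun p => 0 < a' * p.1 + b' * p.2 + c')).card + 3 ∧
      N ≤ (R.filter (fun p => a' * p.1 + b' * p.2 + c' < 0)).card + 3 ∧
      N ≤ (R.filter (fun p => 0 < a' * p.1 + b' * p.2 + c')).card + 3 := by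
  set u : Pt → ℝ := fun p => a * p.1 + b * p.2 + c with hu
  set v : Pt → ℝ := fun p => -b * p.1 + a * p.2 with hv
  set F : Pt → ℝ → ℝ := fun p s => v p - s * u p with hF
  have hFc : ∀ p, Continuous (F p) := by intro p; simp only [hF]; fun_prop
  obtain ⟨f, hfc, hf⟩ := exists_order_stat L F hFc (N - 1) (by omega) (by omega)
  obtain ⟨g, hgc, hg⟩ := exists_order_stat R F hFc (N - 1) (by omega) (by omega)
  have ex1 : ∃ s, 0 ≤ f s - g s := by
    have : ∀ᶠ s : ℝ in Filter.atTop, ∀ p ∈ L, ∀ q ∈ R, F q s ≤ F p s := by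
      rw [Filter.eventually_all_finset]
      intro p hp
      rw [Filter.eventually_all_finset]
      intro q hq
      filter_upwards [Filter.eventually_ge_atTop ((v q - v p) / (u q - u p))] with s hs
      have hpos : 0 < u q - u p := by
        have h1 := hLh p hp; have h2 := hRh q hq; simp only [hu]; linarith
      rw [div_le_iff₀ hpos] at hs
      simp only [hF]; linarith
    obtain ⟨s, hs⟩ := this.exists
    refine ⟨s, ?_⟩
    have h1 : (L.filter (fun p => F p s ≤ f s)).Nonempty :=
      Finset.card_pos.1 (by have := (hf s).1; omega)
    have h2 : (R.filter (fun p => g s ≤ F p s)).Nonempty :=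
      Finset.card_pos.1 (by have := (hg s).2; omega)
    obtain ⟨p, hp⟩ := h1
    obtain ⟨q, hq⟩ := h2
    rw [Finset.mem_filter] at hp hq
    linarith [hs p hp.1 q hq.1]
  have ex2 : ∃ s, f s - g s ≤ 0 := by
    have : ∀ᶠ s : ℝ in Filter.atBot, ∀ p ∈ L, ∀ q ∈ R, F p s ≤ F q s := by
      rw [Filter.eventually_all_finset]
      intro p hp
      rw [Filter.eventually_all_finset]
      intro q hq
      filter_upwards [Filter.eventually_le_atBot ((v q - v p) / (u q - u p))] with s hs
      have hpos : 0 < u q - u p := by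
        have h1 := hLh p hp; have h2 := hRh q hq; simp only [hu]; linarith
      rw [le_div_iff₀ hpos] at hs
      simp only [hF]; linarith
    obtain ⟨s, hs⟩ := this.exists
    refine ⟨s, ?_⟩
    have h1 : (L.filter (fun p => f s ≤ F p s)).Nonempty :=
      Finset.card_pos.1 (by have := (hf s).2; omega)
    have h2 : (R.filter (fun p => F p s ≤ g s)).Nonempty :=
      Finset.card_pos.1 (by have := (hg s).1; omega)
    obtain ⟨p, hp⟩ := h1
    obtain ⟨q, hq⟩ := h2
    rw [Finset.mem_filter] at hp hq
    linarith [hs p hp.1 q hq.1]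
  obtain ⟨s, hs⟩ := mem_range_of_exists_le_of_exists_ge (hfc.sub hgc) ex2 ex1
  have hfg : g s = f s := by
    have : f s - g s = 0 := hs
    linarith
  have hform : ∀ p : Pt, (-b - s * a) * p.1 + (a - s * b) * p.2 + (-s * c - f s) = F p s - f s := by
    intro p; simp only [hF, hu, hv]; ring
  have hnd : (-b - s * a) ≠ 0 ∨ (a - s * b) ≠ 0 := by
    by_contra hcon
    push Not at hcon
    obtain ⟨h1, h2⟩ := hcon
    have hb : b * (1 + s ^ 2) = 0 := by linear_combination -h1 - s * h2
    have hb0 : b = 0 := by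
      rcases mul_eq_zero.1 hb with h | h
      · exact h
      · nlinarith [sq_nonneg s]
    have ha0 : a = 0 := by rw [hb0] at h2; linarith
    rcases hab with h | h
    · exact h ha0
    · exact h hb0
  have count : ∀ S : Finset Pt, S ⊆ P →
      (S.filter (fun p => F p s ≤ f s)).card ≤ (S.filter (fun p => F p s - f s < 0)).card + 2 ∧
      (S.filter (fun p => f s ≤ F p s)).card ≤ (S.filter (fun p => 0 < F p s - f s)).card + 2 := by
    intro S hS
    have h2 := card_line_le_two P S hP hS _ _ (-s * c - f s) hnd
    simp only [hform] at h2
    constructor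
    · have : (S.filter (fun p => F p s ≤ f s)) ⊆
        (S.filter (fun p => F p s - f s < 0)) ∪ (S.filter (fun p => F p s - f s = 0)) := by
        intro p hp
        simp only [Finset.mem_union, Finset.mem_filter] at hp ⊢
        rcases hp.2.lt_or_eq with h | h
        · left; exact ⟨hp.1, by linarith⟩
        · right; exact ⟨hp.1, by linarith⟩
      have h3 := (Finset.card_le_card this).trans (Finset.card_union_le _ _)
      omega
    · have : (S.filter (fun p => f s ≤ F p s)) ⊆
        (S.filter (fun p => 0 < F p s - f s)) ∪ (S.filter (fun p => F p s - f s = 0)) := by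
        intro p hp
        simp only [Finset.mem_union, Finset.mem_filter] at hp ⊢
        rcases hp.2.lt_or_eq with h | h
        · left; exact ⟨hp.1, by linarith⟩
        · right; exact ⟨hp.1, by linarith⟩
      have h3 := (Finset.card_le_card this).trans (Finset.card_union_le _ _)
      omega
  refine ⟨_, _, -s * c - f s, hnd, ?_⟩
  simp only [hform]
  have cL := count L hL
  have cR := count R hR
  have f1 := hf s
  have g1 := hg s
  rw [hfg] at g1
  refine ⟨?_, ?_, ?_, ?_⟩ <;> omega

lemma incomp_mono {S T : Finset Pt} (hST : S ⊆ T) {x y : Pt} (h : Incomp S x y) :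
    Incomp T x y := by
  refine ⟨fun h1 => h.1 ⟨h1.1, fun b hb => h1.2 b (hST hb)⟩,
    fun h1 => h.2 ⟨h1.1, fun b hb => h1.2 b (hST hb)⟩⟩

/-- If the line `xy` meets the hull of `S`, it has a point where any two affine functionals
negative on `S` are negative. -/
lemma incomp_point {S : Finset Pt} {x y : Pt} (hxy : x ≠ y) (h : Incomp S x y)
    (a b c a' b' c' : ℝ) (h1 : ∀ p ∈ S, a * p.1 + b * p.2 + c < 0)
    (h2 : ∀ p ∈ S, a' * p.1 + b' * p.2 + c' < 0) :
    ∃ t : ℝ, a * (x.1 + t * (y.1 - x.1)) + b * (x.2 + t * (y.2 - x.2)) + c < 0 ∧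
      a' * (x.1 + t * (y.1 - x.1)) + b' * (x.2 + t * (y.2 - x.2)) + c' < 0 := by
  obtain ⟨hA, hB⟩ := h
  simp only [LtRel, LeftOf, not_and, not_forall, not_lt] at hA hB
  obtain ⟨p, hp, hpx⟩ := hA hxy
  obtain ⟨q, hq, hqx⟩ := hB hxy.symm
  set A := y.1 - x.1 with hAd
  set B := y.2 - x.2 with hBd
  have hAB : 0 < A ^ 2 + B ^ 2 := by
    by_contra hcon
    have hA0 : A = 0 := by nlinarith [sq_nonneg A, sq_nonneg B]
    have hB0 : B = 0 := by nlinarith [sq_nonneg A, sq_nonneg B]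
    apply hxy
    ext <;> linarith
  -- point on the segment
  obtain ⟨l, hl0, hl1, hl⟩ : ∃ l : ℝ, 0 ≤ l ∧ l ≤ 1 ∧
      A * (((1 - l) * p.2 + l * q.2) - x.2) - B * (((1 - l) * p.1 + l * q.1) - x.1) = 0 := by
    set α := A * (p.2 - x.2) - B * (p.1 - x.1) with hα
    set β := A * (q.2 - x.2) - B * (q.1 - x.1) with hβ
    have hβ0 : 0 ≤ β := by
      have : (x.1 - y.1) * (q.2 - y.2) - (x.2 - y.2) * (q.1 - y.1) = -β := by
        simp only [hβ, hAd, hBd]; ring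
      linarith
    by_cases hz : β - α = 0
    · refine ⟨0, le_rfl, zero_le_one, ?_⟩
      have : α = 0 := by linarith
      linear_combination this
    · have hpos : 0 < β - α := lt_of_le_of_ne (by linarith) (Ne.symm hz)
      refine ⟨-α / (β - α), div_nonneg (by linarith) hpos.le, ?_, ?_⟩
      · rw [div_le_one hpos]; linarith
      · have e : ∀ l : ℝ, A * (((1 - l) * p.2 + l * q.2) - x.2)
            - B * (((1 - l) * p.1 + l * q.1) - x.1) = α + l * (β - α) := by
          intro l; simp only [hα, hβ]; ring
        rw [e]; field_simp; ring
  set z1 := (1 - l) * p.1 + l * q.1 with hz1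
  set z2 := (1 - l) * p.2 + l * q.2 with hz2
  have conv : ∀ α β : ℝ, α < 0 → β < 0 → (1 - l) * α + l * β < 0 := by
    intro α β hα hβ
    rcases hl0.lt_or_eq with h | h
    · nlinarith
    · rw [← h]; linarith
  refine ⟨(A * (z1 - x.1) + B * (z2 - x.2)) / (A ^ 2 + B ^ 2), ?_⟩
  have e1 : x.1 + (A * (z1 - x.1) + B * (z2 - x.2)) / (A ^ 2 + B ^ 2) * A = z1 := by
    field_simp
    linear_combination B * hl
  have e2 : x.2 + (A * (z1 - x.1) + B * (z2 - x.2)) / (A ^ 2 + B ^ 2) * B = z2 := by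
    field_simp
    linear_combination (-A) * hl
  rw [e1, e2]
  constructor
  · have := conv _ _ (h1 p hp) (h1 q hq)
    simp only [hz1, hz2]; linarith
  · have := conv _ _ (h2 p hp) (h2 q hq)
    simp only [hz1, hz2]; linarith

/-- One dimensional sign fact. -/
lemma sign_aux (α β γ δ t₁ t₂ t₃ t₄ : ℝ) (h1 : α + β * t₁ < 0) (h1' : γ + δ * t₁ < 0)
    (h2 : α + β * t₂ < 0) (h2' : 0 < γ + δ * t₂) (h3 : 0 < α + β * t₃) (h3' : γ + δ * t₃ < 0)
    (h4 : 0 < α + β * t₄) (h4' : 0 < γ + δ * t₄) : False := by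
  -- eliminate: the functional `δ * h - β * g` is constant
  have c1 : δ * (α + β * t₁) - β * (γ + δ * t₁) = δ * α - β * γ := by ring
  have c2 : δ * (α + β * t₂) - β * (γ + δ * t₂) = δ * α - β * γ := by ring
  have c3 : δ * (α + β * t₃) - β * (γ + δ * t₃) = δ * α - β * γ := by ring
  have c4 : δ * (α + β * t₄) - β * (γ + δ * t₄) = δ * α - β * γ := by ring
  have hδ : δ ≠ 0 := by rintro rfl; linarith
  generalize α + β * t₁ = H1 at *
  generalize α + β * t₂ = H2 at *
  generalize α + β * t₃ = H3 at *
  generalize α + β * t₄ = H4 at *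
  generalize γ + δ * t₁ = G1 at *
  generalize γ + δ * t₂ = G2 at *
  generalize γ + δ * t₃ = G3 at *
  generalize γ + δ * t₄ = G4 at *
  generalize δ * α - β * γ = κ at *
  -- κ has the sign of -δ and of δ
  rcases lt_or_gt_of_ne hδ with h | h
  · rcases le_total 0 β with hb | hb
    · nlinarith [mul_pos_of_neg_of_neg h h1, mul_neg_of_neg_of_pos h h4,
        mul_nonneg hb (neg_nonneg.2 h1'.le), mul_nonneg hb h4'.le]
    · nlinarith [mul_pos_of_neg_of_neg h h2, mul_neg_of_neg_of_pos h h3,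
        mul_nonneg (neg_nonneg.2 hb) (neg_nonneg.2 h3'.le), mul_nonneg (neg_nonneg.2 hb) h2'.le]
  · rcases le_total 0 β with hb | hb
    · nlinarith [mul_neg_of_pos_of_neg h h2, mul_pos h h3,
        mul_nonneg hb (neg_nonneg.2 h3'.le), mul_nonneg hb h2'.le]
    · nlinarith [mul_neg_of_pos_of_neg h h1, mul_pos h h4,
        mul_nonneg (neg_nonneg.2 hb) (neg_nonneg.2 h1'.le), mul_nonneg (neg_nonneg.2 hb) h4'.le]

/-- A line misses one of the four quadrants. -/
lemma quadrants (LL LR RL RR : Finset Pt) {x y : Pt} (hxy : x ≠ y) (a b c a' b' c' : ℝ)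
    (h1 : ∀ p ∈ LL, a * p.1 + b * p.2 + c < 0) (h1' : ∀ p ∈ LL, a' * p.1 + b' * p.2 + c' < 0)
    (h2 : ∀ p ∈ LR, a * p.1 + b * p.2 + c < 0) (h2' : ∀ p ∈ LR, 0 < a' * p.1 + b' * p.2 + c')
    (h3 : ∀ p ∈ RL, 0 < a * p.1 + b * p.2 + c) (h3' : ∀ p ∈ RL, a' * p.1 + b' * p.2 + c' < 0)
    (h4 : ∀ p ∈ RR, 0 < a * p.1 + b * p.2 + c) (h4' : ∀ p ∈ RR, 0 < a' * p.1 + b' * p.2 + c') :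
    ¬ Incomp LL x y ∨ ¬ Incomp LR x y ∨ ¬ Incomp RL x y ∨ ¬ Incomp RR x y := by
  by_contra hcon
  push Not at hcon
  obtain ⟨i1, i2, i3, i4⟩ := hcon
  obtain ⟨t1, u1, v1⟩ := incomp_point hxy i1 a b c a' b' c' h1 h1'
  obtain ⟨t2, u2, v2⟩ := incomp_point hxy i2 a b c (-a') (-b') (-c') h2
    (fun p hp => by linarith [h2' p hp])
  obtain ⟨t3, u3, v3⟩ := incomp_point hxy i3 (-a) (-b) (-c) a' b' c'
    (fun p hp => by linarith [h3 p hp]) h3'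
  obtain ⟨t4, u4, v4⟩ := incomp_point hxy i4 (-a) (-b) (-c) (-a') (-b') (-c')
    (fun p hp => by linarith [h4 p hp]) (fun p hp => by linarith [h4' p hp])
  apply sign_aux (a * x.1 + b * x.2 + c) (a * (y.1 - x.1) + b * (y.2 - x.2))
    (a' * x.1 + b' * x.2 + c') (a' * (y.1 - x.1) + b' * (y.2 - x.2)) t1 t2 t3 t4 <;> linarith

/-- The number of members of a finite family crossed by the line `xy`. -/
noncomputable def crossNum {κ : Type} [Fintype κ] (F : κ → Finset Pt) (x y : Pt) : ℕ :=
  ∑ i, if Incomp (F i) x y then 1 else 0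

lemma crossNum_zero {κ : Type} [Fintype κ] (F : κ → Finset Pt) (S : Finset Pt) (x y : Pt)
    (hF : ∀ i, F i ⊆ S) (h : ¬ Incomp S x y) : crossNum F x y = 0 := by
  unfold crossNum
  apply Finset.sum_eq_zero
  intro i _
  rw [if_neg]
  exact fun h' => h (incomp_mono (hF i) h')

lemma crossNum_elim {κ μ : Type} [Fintype κ] [Fintype μ] (F : κ → Finset Pt) (G : μ → Finset Pt)
    (x y : Pt) : crossNum (Sum.elim F G) x y = crossNum F x y + crossNum G x y := by
  unfold crossNum
  rw [Fintype.sum_sum_type]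
  rfl

/-- The conjugation tree. -/
lemma tree (P : Finset Pt) (hP : GenPos P) (m : ℕ) (hm : 0 < m) : ∀ d : ℕ, ∀ L R : Finset Pt,
    L ⊆ P → R ⊆ P → ∀ a b c : ℝ, (a ≠ 0 ∨ b ≠ 0) →
    (∀ p ∈ L, a * p.1 + b * p.2 + c < 0) → (∀ p ∈ R, 0 < a * p.1 + b * p.2 + c) →
    2 ^ d * (m + 3) ≤ L.card + 3 → 2 ^ d * (m + 3) ≤ R.card + 3 →
    ∃ (κ μ : Type) (_ : Fintype κ) (_ : Fintype μ) (F : κ → Finset Pt) (G : μ → Finset Pt),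
      Fintype.card κ = 2 ^ d ∧ Fintype.card μ = 2 ^ d ∧
      (∀ i, F i ⊆ L ∧ (F i).card = m) ∧ (∀ i, G i ⊆ R ∧ (G i).card = m) ∧
      ∀ x y : Pt, x ≠ y → crossNum F x y ≤ Nat.fib (d + 2) ∧ crossNum G x y ≤ Nat.fib (d + 2) ∧
        crossNum F x y + crossNum G x y ≤ Nat.fib (d + 3) := by
  intro d
  induction d with
  | zero =>
    intro L R hL hR a b c hab hLh hRh hLc hRc
    obtain ⟨A, hA, hAc⟩ := Finset.exists_subset_card_eq (s := L) (n := m) (by omega)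
    obtain ⟨B, hB, hBc⟩ := Finset.exists_subset_card_eq (s := R) (n := m) (by omega)
    refine ⟨Unit, Unit, inferInstance, inferInstance, fun _ => A, fun _ => B, by simp, by simp,
      fun _ => ⟨hA, hAc⟩, fun _ => ⟨hB, hBc⟩, ?_⟩
    intro x y _
    have e2 : Nat.fib (0 + 2) = 1 := rfl
    have e3 : Nat.fib (0 + 3) = 2 := rfl
    rw [e2, e3]
    simp only [crossNum, Finset.univ_unique, Finset.sum_const, Finset.card_singleton, one_smul]
    split_ifs <;> simp
  | succ d ih =>
    intro L R hL hR a b c hab hLh hRh hLc hRc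
    have hpow : 2 ^ (d + 1) * (m + 3) = 2 * (2 ^ d * (m + 3)) := by ring
    have hN2 : 2 ≤ 2 ^ d * (m + 3) := by
      have : 1 ≤ 2 ^ d := Nat.one_le_two_pow
      nlinarith
    rw [hpow] at hLc hRc
    obtain ⟨a', b', c', hab', k1, k2, k3, k4⟩ :=
      ham_sandwich P L R hP hL hR a b c hab hLh hRh _ hN2 hLc hRc
    set LL := L.filter (fun p => a' * p.1 + b' * p.2 + c' < 0) with hLL
    set LR := L.filter (fun p => 0 < a' * p.1 + b' * p.2 + c') with hLR
    set RL := R.filter (fun p => a' * p.1 + b' * p.2 + c' < 0) with hRL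
    set RR := R.filter (fun p => 0 < a' * p.1 + b' * p.2 + c') with hRR
    have sLL : LL ⊆ L := Finset.filter_subset _ _
    have sLR : LR ⊆ L := Finset.filter_subset _ _
    have sRL : RL ⊆ R := Finset.filter_subset _ _
    have sRR : RR ⊆ R := Finset.filter_subset _ _
    obtain ⟨κ, μ, _, _, F, G, cκ, cμ, hF, hG, hX⟩ := ih LL LR (sLL.trans hL) (sLR.trans hL)
      a' b' c' hab' (fun p hp => (Finset.mem_filter.1 hp).2)
      (fun p hp => (Finset.mem_filter.1 hp).2) k1 k2
    obtain ⟨κ', μ', _, _, F', G', cκ', cμ', hF', hG', hX'⟩ := ih RL RR (sRL.trans hR)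
      (sRR.trans hR) a' b' c' hab' (fun p hp => (Finset.mem_filter.1 hp).2)
      (fun p hp => (Finset.mem_filter.1 hp).2) k3 k4
    refine ⟨κ ⊕ μ, κ' ⊕ μ', inferInstance, inferInstance, Sum.elim F G, Sum.elim F' G', ?_, ?_,
      ?_, ?_, ?_⟩
    · rw [Fintype.card_sum, cκ, cμ]; ring
    · rw [Fintype.card_sum, cκ', cμ']; ring
    · rintro (i | i)
      · exact ⟨(hF i).1.trans sLL, (hF i).2⟩
      · exact ⟨(hG i).1.trans sLR, (hG i).2⟩
    · rintro (i | i)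
      · exact ⟨(hF' i).1.trans sRL, (hF' i).2⟩
      · exact ⟨(hG' i).1.trans sRR, (hG' i).2⟩
    · intro x y hxy
      obtain ⟨x1, x2, x3⟩ := hX x y hxy
      obtain ⟨y1, y2, y3⟩ := hX' x y hxy
      rw [crossNum_elim, crossNum_elim]
      have efib : Nat.fib (d + 1 + 3) = Nat.fib (d + 2) + Nat.fib (d + 3) := Nat.fib_add_two
      have efib2 : d + 1 + 2 = d + 3 := by ring
      rw [efib, efib2]
      refine ⟨x3, y3, ?_⟩
      rcases quadrants LL LR RL RR hxy a b c a' b' c'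
        (fun p hp => hLh p (sLL hp)) (fun p hp => (Finset.mem_filter.1 hp).2)
        (fun p hp => hLh p (sLR hp)) (fun p hp => (Finset.mem_filter.1 hp).2)
        (fun p hp => hRh p (sRL hp)) (fun p hp => (Finset.mem_filter.1 hp).2)
        (fun p hp => hRh p (sRR hp)) (fun p hp => (Finset.mem_filter.1 hp).2)
        with h | h | h | h
      · have := crossNum_zero F LL x y (fun i => (hF i).1) h
        omega
      · have := crossNum_zero G LR x y (fun i => (hG i).1) h
        omega
      · have := crossNum_zero F' RL x y (fun i => (hF' i).1) h
        omega
      · have := crossNum_zero G' RR x y (fun i => (hG' i).1) h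
        omega

lemma iota_le (A B : Finset Pt) :
    iota A B ≤ ∑ z ∈ A.offDiag, if Incomp B z.1 z.2 then 1 else 0 := by
  rw [← Finset.card_filter]
  unfold iota
  have hsub : {s : Finset Pt | ∃ x y : Pt, x ≠ y ∧ s = {x, y} ∧ x ∈ A ∧ y ∈ A ∧ Incomp B x y} ⊆
      (((A.offDiag.filter (fun z => Incomp B z.1 z.2)).image
        (fun z : Pt × Pt => ({z.1, z.2} : Finset Pt)) : Finset (Finset Pt)) :
        Set (Finset Pt)) := by
    rintro s ⟨x, y, hxy, rfl, hx, hy, hi⟩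
    simp only [Finset.coe_image, Set.mem_image, Finset.mem_coe, Finset.mem_filter,
      Finset.mem_offDiag]
    exact ⟨(x, y), ⟨⟨hx, hy, hxy⟩, hi⟩, rfl⟩
  refine (Set.ncard_le_ncard hsub (Finset.finite_toSet _)).trans ?_
  rw [Set.ncard_coe_finset]
  exact Finset.card_image_le

/-- Sum over the family of `iota`. -/
lemma sum_iota_le {κ : Type} [Fintype κ] (G : κ → Finset Pt) (A : Finset Pt) (m k : ℕ)
    (hA : A.card = m) (hG : ∀ x y : Pt, x ≠ y → crossNum G x y ≤ k) :
    ∑ j, iota A (G j) ≤ m ^ 2 * k := by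
  calc ∑ j, iota A (G j)
      ≤ ∑ j, ∑ z ∈ A.offDiag, (if Incomp (G j) z.1 z.2 then 1 else 0) :=
        Finset.sum_le_sum (fun j _ => iota_le A (G j))
    _ = ∑ z ∈ A.offDiag, crossNum G z.1 z.2 := Finset.sum_comm
    _ ≤ ∑ z ∈ A.offDiag, k :=
        Finset.sum_le_sum (fun z hz => hG _ _ (Finset.mem_offDiag.1 hz).2.2)
    _ = A.offDiag.card * k := by simp
    _ ≤ m ^ 2 * k := by
        apply Nat.mul_le_mul_right
        rw [Finset.offDiag_card, hA, sq]
        exact Nat.sub_le _ _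

lemma fib_bound (d : ℕ) : (Nat.fib (d + 2)) ^ 4 ≤ 16 * 8 ^ d := by
  have key : ∀ d : ℕ, (Nat.fib (d + 2) : ℝ) ≤ 2 * (1.63 : ℝ) ^ d ∧
      (Nat.fib (d + 3) : ℝ) ≤ 2 * (1.63 : ℝ) ^ (d + 1) := by
    intro d
    induction d with
    | zero =>
      have e2 : Nat.fib (0 + 2) = 1 := rfl
      have e3 : Nat.fib (0 + 3) = 2 := rfl
      rw [e2, e3]; norm_num
    | succ d ih =>
      refine ⟨ih.2, ?_⟩
      have efib : Nat.fib (d + 1 + 3) = Nat.fib (d + 2) + Nat.fib (d + 3) := Nat.fib_add_two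
      rw [efib]; push_cast
      have hp : (0 : ℝ) < 1.63 ^ d := by positivity
      have e1 : (1.63 : ℝ) ^ (d + 1) = 1.63 ^ d * 1.63 := pow_succ _ _
      have e2 : (1.63 : ℝ) ^ (d + 1 + 1) = 1.63 ^ d * 1.63 * 1.63 := by
        rw [pow_succ, pow_succ]
      have := ih.1; have := ih.2
      rw [e1] at this
      rw [e2]
      nlinarith
  have h := (key d).1
  have h4 : (Nat.fib (d + 2) : ℝ) ^ 4 ≤ (2 * (1.63 : ℝ) ^ d) ^ 4 :=
    pow_le_pow_left₀ (by positivity) h 4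
  have h5 : (2 * (1.63 : ℝ) ^ d) ^ 4 ≤ 16 * 8 ^ d := by
    have : (2 * (1.63 : ℝ) ^ d) ^ 4 = 16 * ((1.63 : ℝ) ^ 4) ^ d := by
      rw [mul_pow, ← pow_mul, ← pow_mul, mul_comm d 4]; norm_num
    rw [this]
    have : ((1.63 : ℝ) ^ 4) ^ d ≤ 8 ^ d := pow_le_pow_left₀ (by positivity) (by norm_num) d
    linarith
  exact_mod_cast h4.trans h5

/-- The separating line. -/
lemma exists_line (P₁ P₂ : Finset Pt) (h : Separated P₁ P₂) (h1 : P₁.Nonempty)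
    (h2 : P₂.Nonempty) : ∃ a b c : ℝ, (a ≠ 0 ∨ b ≠ 0) ∧
      (∀ p ∈ P₁, a * p.1 + b * p.2 + c < 0) ∧ (∀ p ∈ P₂, 0 < a * p.1 + b * p.2 + c) := by
  obtain ⟨f, u, v, hu, huv, hv⟩ := geometric_hahn_banach_compact_closed
    (convex_convexHull ℝ (P₁ : Set Pt)) (P₁.finite_toSet.isCompact_convexHull (𝕜 := ℝ))
    (convex_convexHull ℝ (P₂ : Set Pt)) (P₂.finite_toSet.isCompact_convexHull (𝕜 := ℝ)).isClosed h
  have hf : ∀ p : Pt, f p = f (1, 0) * p.1 + f (0, 1) * p.2 := by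
    intro p
    have : p = p.1 • ((1, 0) : Pt) + p.2 • ((0, 1) : Pt) := by ext <;> simp
    conv_lhs => rw [this]
    rw [map_add, map_smul, map_smul]
    simp only [smul_eq_mul]; ring
  have k1 : ∀ p ∈ P₁, f (1, 0) * p.1 + f (0, 1) * p.2 + (-u) < 0 := by
    intro p hp
    have := hu p (subset_convexHull ℝ _ hp)
    rw [hf] at this; linarith
  have k2 : ∀ p ∈ P₂, 0 < f (1, 0) * p.1 + f (0, 1) * p.2 + (-u) := by
    intro p hp
    have := hv p (subset_convexHull ℝ _ hp)
    rw [hf] at this; linarith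
  refine ⟨f (1, 0), f (0, 1), -u, ?_, k1, k2⟩
  by_contra hcon
  push Not at hcon
  obtain ⟨p, hp⟩ := h1
  obtain ⟨q, hq⟩ := h2
  have e1 := k1 p hp
  have e2 := k2 q hq
  rw [hcon.1, hcon.2] at e1 e2
  linarith

/-- There is an absolute constant `c > 0` with the following property: for every
positive integer `m` and every real `ε ∈ (0,1)`, if `P` is a set of `n ≥ c·m/ε⁴` points in the
plane in general position, partitioned into two separated subsets `P₁`, `P₂` with
`||P₁| − |P₂|| ≤ 1`, then there exist `m`-element sets `A ⊆ P₁` and `B ⊆ P₂` forming an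
`ε`-avoiding pair. -/
theorem stmt6 :
    ∃ c : ℝ, 0 < c ∧ ∀ m : ℕ, 0 < m → ∀ ε : ℝ, 0 < ε → ε < 1 →
      ∀ P P₁ P₂ : Finset Pt, GenPos P → c * (m : ℝ) / ε ^ 4 ≤ (P.card : ℝ) →
        P₁ ∪ P₂ = P → Disjoint P₁ P₂ → Separated P₁ P₂ →
        ((P₁.card : ℤ) - (P₂.card : ℤ)).natAbs ≤ 1 →
        ∃ A B : Finset Pt, A ⊆ P₁ ∧ B ⊆ P₂ ∧ A.card = m ∧ B.card = m ∧
          EpsAvoiding ε m A B := by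
  refine ⟨4096, by norm_num, ?_⟩
  intro m hm ε hε hε1 P P₁ P₂ hP hn hU hD hS hbal
  have hm1 : (1 : ℝ) ≤ m := by exact_mod_cast hm
  have hε4 : 0 < ε ^ 4 := by positivity
  have hε41 : ε ^ 4 ≤ 1 := pow_le_one₀ hε.le hε1.le
  -- choose the depth
  obtain ⟨d, hd1, hd2⟩ := exists_nat_pow_near (x := 256 / ε ^ 4) (y := (2 : ℝ))
    (by rw [le_div_iff₀ hε4]; linarith) (by norm_num)
  have hcard : P.card = P₁.card + P₂.card := by
    rw [← hU, Finset.card_union_of_disjoint hD]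
  have hbig : (2 : ℝ) ^ (d + 1) * (m + 3) * 2 ≤ P.card := by
    refine le_trans ?_ hn
    have : (2 : ℝ) ^ (d + 1) ≤ 512 / ε ^ 4 := by
      rw [pow_succ]
      have e : (512 : ℝ) / ε ^ 4 = 256 / ε ^ 4 * 2 := by ring
      rw [e]; linarith
    calc (2 : ℝ) ^ (d + 1) * (m + 3) * 2 ≤ 512 / ε ^ 4 * (m + 3 * m) * 2 := by
          gcongr; linarith
      _ = 4096 * m / ε ^ 4 := by ring
  have hbigN : 2 ^ (d + 1) * (m + 3) * 2 ≤ P.card := by exact_mod_cast hbig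
  have hX : 2 ≤ 2 ^ (d + 1) * (m + 3) := by
    have : 1 ≤ 2 ^ (d + 1) := Nat.one_le_two_pow
    nlinarith
  have hc1 : 2 ^ (d + 1) * (m + 3) ≤ P₁.card + 3 := by omega
  have hc2 : 2 ^ (d + 1) * (m + 3) ≤ P₂.card + 3 := by omega
  obtain ⟨a, b, c, hab, k1, k2⟩ := exists_line P₁ P₂ hS (Finset.card_pos.1 (by omega))
    (Finset.card_pos.1 (by omega))
  obtain ⟨κ, μ, _, _, F, G, cκ, cμ, hF, hG, hX⟩ := tree P hP m hm (d + 1) P₁ P₂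
    (hU ▸ Finset.subset_union_left) (hU ▸ Finset.subset_union_right) a b c hab k1 k2 hc1 hc2
  set N := 2 ^ (d + 1) with hN
  set k := Nat.fib (d + 1 + 2) with hk
  have hsum : ∑ z : κ × μ, (iota (F z.1) (G z.2) + iota (G z.2) (F z.1)) ≤
      2 * N * (m ^ 2 * k) := by
    rw [Finset.sum_add_distrib]
    have s1 : ∑ z : κ × μ, iota (F z.1) (G z.2) ≤ N * (m ^ 2 * k) := by
      rw [Fintype.sum_prod_type]
      refine (Finset.sum_le_sum (fun i _ => sum_iota_le G (F i) m k (hF i).2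
        (fun x y hxy => (hX x y hxy).2.1))).trans ?_
      simp [cκ]
    have s2 : ∑ z : κ × μ, iota (G z.2) (F z.1) ≤ N * (m ^ 2 * k) := by
      rw [Fintype.sum_prod_type_right]
      refine (Finset.sum_le_sum (fun i _ => sum_iota_le F (G i) m k (hG i).2
        (fun x y hxy => (hX x y hxy).1))).trans ?_
      simp [cμ]
    linarith
  have hNpos : 0 < N := by positivity
  have hne : (Finset.univ : Finset (κ × μ)).Nonempty := by
    rw [← Finset.card_pos, Finset.card_univ, Fintype.card_prod, cκ, cμ]
    positivity
  obtain ⟨⟨i, j⟩, -, hij⟩ : ∃ z ∈ (Finset.univ : Finset (κ × μ)),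
      N * (iota (F z.1) (G z.2) + iota (G z.2) (F z.1)) ≤ 2 * (m ^ 2 * k) := by
    apply Finset.exists_le_of_sum_le hne
    rw [← Finset.mul_sum, Finset.sum_const, Finset.card_univ, Fintype.card_prod, cκ, cμ,
      smul_eq_mul]
    calc N * _ ≤ N * (2 * N * (m ^ 2 * k)) := Nat.mul_le_mul_left _ hsum
      _ = N * N * (2 * (m ^ 2 * k)) := by ring
  refine ⟨F i, G j, (hF i).1, (hG j).1, (hF i).2, (hG j).2, ?_⟩
  unfold EpsAvoiding
  have hij' : (N : ℝ) * ((iota (F i) (G j) : ℝ) + (iota (G j) (F i) : ℝ)) ≤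
      2 * ((m : ℝ) ^ 2 * k) := by exact_mod_cast hij
  -- 2 k ≤ ε N
  have hkN : 2 * (k : ℝ) ≤ ε * N := by
    have hfib : (k : ℝ) ^ 4 ≤ 16 * 8 ^ (d + 1) := by exact_mod_cast fib_bound (d + 1)
    have hNr : (N : ℝ) = 2 ^ (d + 1) := by simp [hN]
    have h256 : 256 ≤ ε ^ 4 * N := by
      rw [div_lt_iff₀ hε4] at hd2
      rw [hNr]; linarith
    have h8 : (8 : ℝ) ^ (d + 1) = (N : ℝ) ^ 3 := by
      rw [hNr, ← pow_mul, mul_comm, pow_mul]; norm_num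
    have hN3 : (0 : ℝ) ≤ (N : ℝ) ^ 3 := by positivity
    refine le_of_pow_le_pow_left₀ (n := 4) (by norm_num) (by positivity) ?_
    rw [mul_pow, mul_pow]
    rw [h8] at hfib
    nlinarith
  have hNr0 : (0 : ℝ) < N := by exact_mod_cast hNpos
  have hm2 : (0 : ℝ) ≤ (m : ℝ) ^ 2 := by positivity
  have : (N : ℝ) * ((iota (F i) (G j) : ℝ) + (iota (G j) (F i) : ℝ)) ≤
      N * (ε * (m : ℝ) ^ 2) := by nlinarith
  exact le_of_mul_le_mul_left this hNr0
end

section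
/- Let s be a positive integer and set K = 8^{s(s−1)/2}, M = 9^s·K, and ε = 2^{−3s−11}. If A and B are separated M-element point sets in the plane forming an ε-avoiding pair and A ∪ B is in general position, then there exist K pairwise crossing segments, each connecting a point of A to a point of B. -/
open scoped Classical

/-- Orientation determinant. -/
noncomputable def orn (x y b : Pt) : ℝ := (y.1 - x.1) * (b.2 - x.2) - (y.2 - x.2) * (b.1 - x.1)

/-- Linear separation together with the needed part of general position. -/
def Cfg (A B : Finset Pt) : Prop :=
  (∃ p q c : ℝ, (∀ a ∈ A, c < p * a.1 + q * a.2) ∧ ∀ b ∈ B, p * b.1 + q * b.2 < c) ∧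
  (∀ x ∈ A, ∀ y ∈ A, x ≠ y → ∀ b ∈ B, orn x y b ≠ 0) ∧
  (∀ x ∈ B, ∀ y ∈ B, x ≠ y → ∀ b ∈ A, orn x y b ≠ 0)

theorem Cfg.symm {A B : Finset Pt} (h : Cfg A B) : Cfg B A := by
  obtain ⟨⟨p, q, c, h1, h2⟩, h3, h4⟩ := h
  refine ⟨⟨-p, -q, -c, fun b hb => ?_, fun a ha => ?_⟩, h4, h3⟩
  · linarith [h2 b hb]
  · linarith [h1 a ha]

theorem Cfg.mono {A B A' B' : Finset Pt} (h : Cfg A B) (hA : A' ⊆ A) (hB : B' ⊆ B) :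
    Cfg A' B' := by
  obtain ⟨⟨p, q, c, h1, h2⟩, h3, h4⟩ := h
  exact ⟨⟨p, q, c, fun a ha => h1 a (hA ha), fun b hb => h2 b (hB hb)⟩,
    fun x hx y hy hxy b hb => h3 x (hA hx) y (hA hy) hxy b (hB hb),
    fun x hx y hy hxy b hb => h4 x (hB hx) y (hB hy) hxy b (hA hb)⟩

theorem leftOf_iff (x y b : Pt) : LeftOf x y b ↔ 0 < orn x y b := Iff.rfl

theorem orn_swap (x y b : Pt) : orn y x b = - orn x y b := by
  unfold orn; ring

theorem leftOf_irrefl (x b : Pt) : ¬ LeftOf x x b := by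
  simp [LeftOf]

/-- Transitivity of the angular order around a point. -/
theorem leftOf_trans {A B : Finset Pt} (h : Cfg A B) {x y z b : Pt} (hx : x ∈ A) (hy : y ∈ A)
    (hz : z ∈ A) (hb : b ∈ B) (h1 : LeftOf x y b) (h2 : LeftOf y z b) : LeftOf x z b := by
  obtain ⟨⟨p, q, c, hA, hB⟩, -, -⟩ := h
  rw [leftOf_iff] at *
  have fx := hA x hx
  have fy := hA y hy
  have fz := hA z hz
  have fb := hB b hb
  have key : (p * (y.1 - b.1) + q * (y.2 - b.2)) * orn x z b =
      (p * (x.1 - b.1) + q * (x.2 - b.2)) * orn y z b +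
      (p * (z.1 - b.1) + q * (z.2 - b.2)) * orn x y b := by
    unfold orn; ring
  have e1 : 0 < (p * (x.1 - b.1) + q * (x.2 - b.2)) := by linarith
  have e2 : 0 < (p * (y.1 - b.1) + q * (y.2 - b.2)) := by linarith
  have e3 : 0 < (p * (z.1 - b.1) + q * (z.2 - b.2)) := by linarith
  have : 0 < (p * (y.1 - b.1) + q * (y.2 - b.2)) * orn x z b := by
    rw [key]; positivity
  exact (pos_iff_pos_of_mul_pos this).1 e2

theorem ltRel_trans {A B : Finset Pt} (h : Cfg A B) (hne : B.Nonempty) {x y z : Pt} (hx : x ∈ A)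
    (hy : y ∈ A) (hz : z ∈ A) (h1 : LtRel B x y) (h2 : LtRel B y z) : LtRel B x z := by
  have key : ∀ b ∈ B, LeftOf x z b := fun b hb =>
    leftOf_trans h hx hy hz hb (h1.2 b hb) (h2.2 b hb)
  refine ⟨?_, key⟩
  rintro rfl
  obtain ⟨b, hb⟩ := hne
  exact leftOf_irrefl _ _ (key b hb)

theorem ltRel_mono {B B' : Finset Pt} (hB : B' ⊆ B) {x y : Pt} (h : LtRel B x y) :
    LtRel B' x y := ⟨h.1, fun b hb => h.2 b (hB hb)⟩

theorem incomp_signs {A B : Finset Pt} (h : Cfg A B) {x y : Pt} (hx : x ∈ A) (hy : y ∈ A)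
    (hxy : x ≠ y) (hi : Incomp B x y) :
    (∃ b ∈ B, 0 < orn x y b) ∧ (∃ b ∈ B, orn x y b < 0) := by
  obtain ⟨h1, h2⟩ := hi
  unfold LtRel at h1 h2
  push Not at h1 h2
  obtain ⟨b1, hb1, k1⟩ := h1 hxy
  obtain ⟨b2, hb2, k2⟩ := h2 hxy.symm
  rw [leftOf_iff] at k1 k2
  rw [orn_swap] at k2
  have n1 := h.2.1 x hx y hy hxy b1 hb1
  have n2 := h.2.1 x hx y hy hxy b2 hb2
  exact ⟨⟨b2, hb2, lt_of_le_of_ne (by linarith) (Ne.symm n2)⟩,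
    ⟨b1, hb1, lt_of_le_of_ne (by linarith) n1⟩⟩

/-- A line through two points of `A` splits at most one of the blocks of `B`. -/
theorem split_once {A B C D : Finset Pt} (h : Cfg A B) (hC : C ⊆ B) (hD : D ⊆ B)
    (hCD : ∀ b ∈ C, ∀ b' ∈ D, LtRel A b b') {x y : Pt} (hx : x ∈ A) (hy : y ∈ A)
    (hxy : x ≠ y) (h1 : Incomp C x y) (h2 : Incomp D x y) : False := by
  obtain ⟨⟨b1, hb1, p1⟩, ⟨b2, hb2, p2⟩⟩ := incomp_signs (h.mono subset_rfl hC) hx hy hxy h1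
  obtain ⟨⟨d1, hd1, q1⟩, ⟨d2, hd2, q2⟩⟩ := incomp_signs (h.mono subset_rfl hD) hx hy hxy h2
  obtain ⟨⟨p, q, c, hA, hB⟩, -, -⟩ := h
  have key : ∀ b d : Pt, (p * (x.1 - b.1) + q * (x.2 - b.2)) * orn x y d =
      (p * (x.1 - y.1) + q * (x.2 - y.2)) * orn b d x +
      (p * (x.1 - d.1) + q * (x.2 - d.2)) * orn x y b := by
    intro b d; unfold orn; ring
  have fx := hA x hx
  have g : ∀ b ∈ B, 0 < (p * (x.1 - b.1) + q * (x.2 - b.2)) := fun b hb => by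
    linarith [hB b hb]
  rcases le_total 0 (p * (x.1 - y.1) + q * (x.2 - y.2)) with hv | hv
  · have k := key b1 d2
    have o : 0 < orn b1 d2 x := (hCD b1 hb1 d2 hd2).2 x hx
    have := mul_neg_of_pos_of_neg (g b1 (hC hb1)) q2
    have := mul_pos (g d2 (hD hd2)) p1
    have := mul_nonneg hv o.le
    linarith
  · have k := key b2 d1
    have o : 0 < orn b2 d1 x := (hCD b2 hb2 d1 hd1).2 x hx
    have := mul_pos (g b2 (hC hb2)) q1
    have := mul_neg_of_pos_of_neg (g d1 (hD hd1)) p2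
    have := mul_nonpos_of_nonpos_of_nonneg hv o.le
    linarith

/-- Crossing criterion. -/
theorem cross_of {a a' b b' : Pt} (h1 : 0 < orn a a' b) (h2 : 0 < orn a a' b')
    (h3 : 0 < orn b b' a) (h4 : 0 < orn b b' a') : SegCross (a, b) (a', b') := by
  set S := orn a a' b' + orn b b' a' with hS
  have hS0 : 0 < S := by positivity
  have hS' : S = orn a a' b + orn b b' a := by rw [hS]; unfold orn; ring
  have hSne := hS0.ne'
  refine ⟨((orn b b' a' / S) * a.1 + (orn a a' b' / S) * b.1,
    (orn b b' a' / S) * a.2 + (orn a a' b' / S) * b.2), ?_, ?_, ?_⟩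
  · apply Set.eq_singleton_iff_unique_mem.2
    constructor
    · constructor
      · refine ⟨orn b b' a' / S, orn a a' b' / S, by positivity, by positivity, ?_, ?_⟩
        · field_simp; rw [hS]; ring
        · simp [Prod.ext_iff]
      · refine ⟨orn b b' a / S, orn a a' b / S, by positivity, by positivity, ?_, ?_⟩
        · field_simp; rw [hS']; ring
        · simp only [Prod.ext_iff, Prod.fst_add, Prod.snd_add, Prod.smul_fst, Prod.smul_snd,
            smul_eq_mul]
          constructor <;> field_simp <;> unfold orn <;> ring
    · rintro ⟨z1, z2⟩ ⟨⟨u, v, hu, hv, huv, hz⟩, ⟨u', v', hu', hv', huv', hz'⟩⟩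
      simp only [Prod.ext_iff, Prod.fst_add, Prod.snd_add, Prod.smul_fst, Prod.smul_snd,
            smul_eq_mul] at hz hz' ⊢
      have eu : u = 1 - v := by linarith
      have eu' : u' = 1 - v' := by linarith
      subst eu eu'
      obtain ⟨hz1, hz2⟩ := hz
      obtain ⟨hz1', hz2'⟩ := hz'
      have hv : v * S = orn a a' b' := by
        have e1 : (1 - v) * a.1 + v * b.1 - ((1 - v') * a'.1 + v' * b'.1) = 0 := by linarith
        have e2 : (1 - v) * a.2 + v * b.2 - ((1 - v') * a'.2 + v' * b'.2) = 0 := by linarith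
        rw [hS]; unfold orn
        linear_combination (b'.2 - a'.2) * e1 - (b'.1 - a'.1) * e2
      have hv2 : v = orn a a' b' / S := by field_simp; linarith
      have hv3 : 1 - v = orn b b' a' / S := by
        rw [hv2]; field_simp; rw [hS]; ring
      rw [← hv3, ← hv2]
      exact ⟨hz1.symm, hz2.symm⟩
  · refine ⟨orn b b' a' / S, orn a a' b' / S, by positivity, by positivity, ?_, ?_⟩
    · field_simp; rw [hS]; ring
    · simp [Prod.ext_iff]
  · refine ⟨orn b b' a / S, orn a a' b / S, by positivity, by positivity, ?_, ?_⟩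
    · field_simp; rw [hS']; ring
    · simp only [Prod.ext_iff, Prod.fst_add, Prod.snd_add, Prod.smul_fst, Prod.smul_snd,
            smul_eq_mul]
      constructor <;> field_simp <;> unfold orn <;> ring

theorem SegCross.symm {e f : Pt × Pt} (h : SegCross e f) : SegCross f e := by
  obtain ⟨x, h1, h2, h3⟩ := h
  exact ⟨x, by rw [Set.inter_comm]; exact h1, h3, h2⟩

/-- Ordered incomparable pairs. -/
noncomputable def incPairs (A B : Finset Pt) : Finset (Pt × Pt) :=
  (A ×ˢ A).filter fun z => z.1 ≠ z.2 ∧ Incomp B z.1 z.2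

theorem incPairs_le (A B : Finset Pt) : (incPairs A B).card ≤ 2 * iota A B := by
  have hfin : {s : Finset Pt | ∃ x y : Pt, x ≠ y ∧ s = {x, y} ∧ x ∈ A ∧ y ∈ A ∧
      Incomp B x y}.Finite := by
    refine (A.powerset.finite_toSet).subset ?_
    rintro s ⟨x, y, -, rfl, hx, hy, -⟩
    rw [Finset.mem_coe, Finset.mem_powerset]
    intro z hz
    rw [Finset.mem_insert, Finset.mem_singleton] at hz
    rcases hz with rfl | rfl <;> assumption
  have him : ((incPairs A B).image fun z => ({z.1, z.2} : Finset Pt)).card ≤ iota A B := by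
    unfold iota
    rw [← Set.ncard_coe_finset]
    refine Set.ncard_le_ncard ?_ hfin
    intro s hs
    simp only [Finset.coe_image, Set.mem_image, Finset.mem_coe, incPairs, Finset.mem_filter,
      Finset.mem_product] at hs
    obtain ⟨z, ⟨⟨h1, h2⟩, h3, h4⟩, rfl⟩ := hs
    exact ⟨z.1, z.2, h3, rfl, h1, h2, h4⟩
  have := Finset.card_le_mul_card_image (f := fun z : Pt × Pt => ({z.1, z.2} : Finset Pt))
    (incPairs A B) 2 (by
      intro s hs
      obtain ⟨w, hw, rfl⟩ := Finset.mem_image.1 hs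
      refine (Finset.card_le_card (t := {(w.1, w.2), (w.2, w.1)}) ?_).trans Finset.card_le_two
      intro z hz
      simp only [Finset.mem_filter, incPairs] at hz hw
      obtain ⟨⟨-, hzne, -⟩, he⟩ := hz
      have a1 : z.1 ∈ ({w.1, w.2} : Finset Pt) := by rw [← he]; simp
      have a2 : z.2 ∈ ({w.1, w.2} : Finset Pt) := by rw [← he]; simp
      simp only [Finset.mem_insert, Finset.mem_singleton, Prod.ext_iff] at a1 a2 ⊢
      grind)
  omega

/-- Abstract block decomposition. -/
theorem blocks {α : Type*} (A : Finset α) (P L : α → α → Prop)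
    (Lirr : ∀ x, ¬ L x x)
    (Ltr : ∀ x ∈ A, ∀ y ∈ A, ∀ z ∈ A, L x y → L y z → L x z)
    (Ltot : ∀ x ∈ A, ∀ y ∈ A, x ≠ y → L x y ∨ L y x)
    (Ptr : ∀ x ∈ A, ∀ y ∈ A, ∀ z ∈ A, P x y → P y z → P x z)
    (PL : ∀ x ∈ A, ∀ y ∈ A, P x y → L x y)
    (N m : ℕ) (hm : 0 < m) (hA : A.card = 9 * N * m)
    (hJ : 8192 * ((A ×ˢ A).filter fun z => z.1 ≠ z.2 ∧ (¬ P z.1 z.2 ∧ ¬ P z.2 z.1)).card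
      ≤ 81 * N * m ^ 2) :
    ∃ C : ℕ → Finset α, ∀ i < 5 * N, C i ⊆ A ∧ (C i).card = m ∧
      ∀ j < 5 * N, i < j → ∀ x ∈ C i, ∀ y ∈ C j, P x y := by
  set J := (A ×ˢ A).filter fun z => z.1 ≠ z.2 ∧ (¬ P z.1 z.2 ∧ ¬ P z.2 z.1) with hJdef
  set inc : α → Finset α := fun x => A.filter fun y => x ≠ y ∧ (¬ P x y ∧ ¬ P y x) with hinc
  set d := m / 4 with hd
  set A' := A.filter fun x => (inc x).card ≤ d with hA'
  set Bd := A.filter fun x => ¬ (inc x).card ≤ d with hBd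
  have hsum : A'.card + Bd.card = A.card := Finset.card_filter_add_card_filter_not _
  have hBdJ : Bd.card * (d + 1) ≤ J.card := by
    have : Bd.card * (d + 1) ≤ ∑ x ∈ Bd, (inc x).card := by
      rw [← smul_eq_mul]
      refine Finset.card_nsmul_le_sum _ _ _ fun x hx => ?_
      have := (Finset.mem_filter.1 hx).2
      omega
    refine this.trans ?_
    rw [← Finset.card_sigma]
    refine Finset.card_le_card_of_injOn (fun z => (z.1, z.2)) ?_ ?_
    · rintro ⟨x, y⟩ hz
      simp only [Finset.coe_sigma, Set.mem_sigma_iff, Finset.mem_coe] at hz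
      have h1 := (Finset.mem_filter.1 hz.1).1
      have h2 := Finset.mem_filter.1 hz.2
      simp only [hJdef, Finset.coe_filter, Set.mem_ofPred_eq, Finset.mem_product]
      exact ⟨⟨h1, h2.1⟩, h2.2⟩
    · rintro ⟨x, y⟩ _ ⟨x', y'⟩ _ h
      simp only [Prod.mk.injEq] at h
      obtain ⟨rfl, rfl⟩ := h
      rfl
  have hBd1 : Bd.card ≤ N * m := by
    have h4 : m ≤ 4 * (d + 1) := by omega
    have h5 : Bd.card * m ≤ 4 * J.card := by nlinarith
    have h6 : 2048 * Bd.card * m ≤ (81 * N * m) * m := by nlinarith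
    have h7 := Nat.le_of_mul_le_mul_right h6 hm
    nlinarith
  have hA'c : 5 * N * (m + 2 * d) ≤ A'.card := by
    have : 2 * (2 * d) ≤ m := by omega
    have : 5 * N * (2 * (m + 2 * d)) ≤ 5 * N * (3 * m) := Nat.mul_le_mul_left _ (by omega)
    nlinarith
  have hsub : A' ⊆ A := Finset.filter_subset _ _
  set rk : α → ℕ := fun x => (A'.filter fun z => L z x).card with hrk
  have rklt : ∀ x ∈ A', ∀ y ∈ A', L x y → rk x < rk y := by
    intro x hx y hy hxy
    refine Finset.card_lt_card ?_
    refine Finset.ssubset_iff_of_subset ?_ |>.2 ⟨x, by simp [hx, hxy], by simp [Lirr]⟩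
    intro z hz
    simp only [Finset.mem_filter] at hz ⊢
    exact ⟨hz.1, Ltr z (hsub hz.1) x (hsub hx) y (hsub hy) hz.2 hxy⟩
  have rkinj : Set.InjOn rk A' := by
    intro x hx y hy hxy
    by_contra hne
    rcases Ltot x (hsub hx) y (hsub hy) hne with h | h
    · have := rklt x hx y hy h; omega
    · have := rklt y hy x hx h; omega
  have rkL : ∀ x ∈ A', ∀ y ∈ A', rk x < rk y → L x y := by
    intro x hx y hy hlt
    have hne : x ≠ y := by rintro rfl; omega
    rcases Ltot x (hsub hx) y (hsub hy) hne with h | h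
    · exact h
    · have := rklt y hy x hx h; omega
  have rkimg : A'.image rk = Finset.range A'.card := by
    refine Finset.eq_of_subset_of_card_le ?_ ?_
    · intro k hk
      obtain ⟨x, hx, rfl⟩ := Finset.mem_image.1 hk
      rw [Finset.mem_range]
      refine Finset.card_lt_card ?_
      refine Finset.ssubset_iff_of_subset (Finset.filter_subset _ _) |>.2
        ⟨x, hx, by simp [Lirr]⟩
    · rw [Finset.card_image_of_injOn rkinj, Finset.card_range]
  have cnt : ∀ s t : ℕ, t ≤ A'.card →
      (A'.filter fun x => s ≤ rk x ∧ rk x < t).card = t - s := by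
    intro s t ht
    rw [← Finset.card_image_of_injOn (rkinj.mono (Finset.coe_subset.2 (Finset.filter_subset _ _))),
      ← Nat.card_Ico]
    congr 1
    ext k
    simp only [Finset.mem_image, Finset.mem_filter, Finset.mem_Ico]
    constructor
    · rintro ⟨x, ⟨_, h⟩, rfl⟩; exact h
    · intro hk
      have : k ∈ A'.image rk := by rw [rkimg, Finset.mem_range]; omega
      obtain ⟨x, hx, rfl⟩ := Finset.mem_image.1 this
      exact ⟨x, ⟨hx, hk⟩, rfl⟩
  set p := m + 2 * d with hp
  have hle : ∀ i < 5 * N, i * p + p ≤ A'.card := by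
    intro i hi
    have : (i + 1) * p ≤ 5 * N * p := Nat.mul_le_mul_right _ hi
    linarith
  refine ⟨fun i => A'.filter fun x => i * p ≤ rk x ∧ rk x < i * p + m, fun i hi =>
    ⟨(Finset.filter_subset _ _).trans hsub, ?_, ?_⟩⟩
  · have := hle i hi
    rw [cnt _ _ (by omega)]; omega
  · intro j hj hij x hx y hy
    simp only [Finset.mem_filter] at hx hy
    obtain ⟨hx, hx1, hx2⟩ := hx
    obtain ⟨hy, hy1, hy2⟩ := hy
    have hgap : i * p + p ≤ j * p := by
      have : (i + 1) * p ≤ j * p := Nat.mul_le_mul_right _ hij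
      linarith
    have hxy : rk x < rk y := by omega
    have hLxy := rkL x hx y hy hxy
    have hne : x ≠ y := by rintro rfl; omega
    by_contra hP
    have hP' : ¬ P y x := fun h => Lirr x
      (Ltr x (hsub hx) y (hsub hy) x (hsub hx) hLxy (PL y (hsub hy) x (hsub hx) h))
    have hmid := cnt (rk x + 1) (rk y) (by have := hle j hj; omega)
    have hsubset : (A'.filter fun z => rk x + 1 ≤ rk z ∧ rk z < rk y) ⊆
        (inc x).erase y ∪ inc y := by
      intro z hz
      simp only [Finset.mem_filter] at hz
      obtain ⟨hz, hz1, hz2⟩ := hz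
      have hxz : x ≠ z := by rintro rfl; omega
      have hzy : y ≠ z := by rintro rfl; omega
      have L1 := rkL x hx z hz (by omega)
      have L2 := rkL z hz y hy hz2
      have n1 : ¬ P z x := fun h => Lirr x
        (Ltr x (hsub hx) z (hsub hz) x (hsub hx) L1 (PL z (hsub hz) x (hsub hx) h))
      have n2 : ¬ P y z := fun h => Lirr y
        (Ltr y (hsub hy) z (hsub hz) y (hsub hy) (PL y (hsub hy) z (hsub hz) h) L2)
      rw [Finset.mem_union, Finset.mem_erase]
      simp only [hinc, Finset.mem_filter]
      by_cases hpz : P x z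
      · right
        refine ⟨hsub hz, hzy, n2, fun h => hP (Ptr x (hsub hx) z (hsub hz) y (hsub hy) hpz h)⟩
      · left
        exact ⟨hzy.symm, hsub hz, hxz, hpz, n1⟩
    have c1 := Finset.card_le_card hsubset
    have c2 := Finset.card_union_le ((inc x).erase y) (inc y)
    have hyin : y ∈ inc x := by
      simp only [hinc, Finset.mem_filter]
      exact ⟨hsub hy, hne, hP, hP'⟩
    have c3 := Finset.card_erase_add_one hyin
    have c4 := (Finset.mem_filter.1 hx).2
    have c5 := (Finset.mem_filter.1 hy).2
    omega

theorem geoBlocks {A B : Finset Pt} (h : Cfg A B) (hB : B.Nonempty)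
    (N m : ℕ) (hm : 0 < m) (hA : A.card = 9 * N * m)
    (hJ : 8192 * (incPairs A B).card ≤ 81 * N * m ^ 2) :
    ∃ C : ℕ → Finset Pt, ∀ i < 5 * N, C i ⊆ A ∧ (C i).card = m ∧
      ∀ j < 5 * N, i < j → ∀ x ∈ C i, ∀ y ∈ C j, LtRel B x y := by
  obtain ⟨b, hb⟩ := hB
  refine blocks A (LtRel B) (fun x y => LeftOf x y b) (fun x => leftOf_irrefl x b)
    (fun x hx y hy z hz => leftOf_trans h hx hy hz hb) ?_
    (fun x hx y hy z hz => ltRel_trans h ⟨b, hb⟩ hx hy hz) (fun x _ y _ hxy => hxy.2 b hb)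
    N m hm hA (by unfold incPairs Incomp at hJ; convert hJ)
  intro x hx y hy hxy
  have := h.2.1 x hx y hy hxy b hb
  simp only [leftOf_iff]
  rw [orn_swap x y]
  rcases lt_or_gt_of_ne this with h | h
  · right; linarith
  · left; exact h

/-- The incomparabilities inside block pairs add up to at most all incomparabilities. -/
theorem sum_incPairs {A B : Finset Pt} (h : Cfg A B) (hne : B.Nonempty) (R : ℕ)
    (C D : ℕ → Finset Pt)
    (hC : ∀ i < R, C i ⊆ A) (hD : ∀ i < R, D i ⊆ B)
    (hCC : ∀ i < R, ∀ j < R, i < j → ∀ x ∈ C i, ∀ y ∈ C j, LtRel B x y)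
    (hDD : ∀ i < R, ∀ j < R, i < j → ∀ x ∈ D i, ∀ y ∈ D j, LtRel A x y) :
    ∑ z ∈ Finset.range R ×ˢ Finset.range R, (incPairs (C z.1) (D z.2)).card
      ≤ (incPairs A B).card := by
  rw [← Finset.card_biUnion]
  · refine Finset.card_le_card ?_
    intro w hw
    simp only [Finset.mem_biUnion, Finset.mem_product, Finset.mem_range, incPairs,
      Finset.mem_filter] at hw ⊢
    obtain ⟨z, ⟨z1, z2⟩, ⟨w1, w2⟩, w3, w4⟩ := hw
    exact ⟨⟨hC _ z1 w1, hC _ z1 w2⟩, w3, fun k => w4.1 (ltRel_mono (hD _ z2) k),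
      fun k => w4.2 (ltRel_mono (hD _ z2) k)⟩
  · rintro ⟨i, j⟩ hz ⟨i', j'⟩ hz' hzz
    replace hz : i < R ∧ j < R := by simpa using hz
    replace hz' : i' < R ∧ j' < R := by simpa using hz'
    rw [Function.onFun, Finset.disjoint_left]
    rintro ⟨x, y⟩ hw hw'
    simp only [incPairs, Finset.mem_filter, Finset.mem_product] at hw hw'
    obtain ⟨⟨hx, hy⟩, hxy, hi⟩ := hw
    obtain ⟨⟨hx', hy'⟩, -, hi'⟩ := hw'
    have e1 : i = i' := by
      rcases lt_trichotomy i i' with hl | hl | hl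
      · exact absurd rfl (hCC i hz.1 i' hz'.1 hl x hx x hx').1
      · exact hl
      · exact absurd rfl (hCC i' hz'.1 i hz.1 hl x hx' x hx).1
    have e2 : j = j' := by
      rcases lt_trichotomy j j' with hl | hl | hl
      · exact (split_once h (hD j hz.2) (hD j' hz'.2) (hDD j hz.2 j' hz'.2 hl)
          (hC i hz.1 hx) (hC i hz.1 hy) hxy hi hi').elim
      · exact hl
      · exact (split_once h (hD j' hz'.2) (hD j hz.2) (hDD j' hz'.2 j hz.2 hl)
          (hC i hz.1 hx) (hC i hz.1 hy) hxy hi' hi).elim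
    exact hzz (by rw [e1, e2])

/-- One step of the recursion. -/
theorem step {A B : Finset Pt} (h : Cfg A B) (N m K : ℕ) (hN : 0 < N) (hm : 0 < m)
    (hA : A.card = 9 * N * m) (hB : B.card = 9 * N * m)
    (hJ : 8192 * ((incPairs A B).card + (incPairs B A).card) ≤ 81 * N * m ^ 2)
    (ih : ∀ A' B' : Finset Pt, Cfg A' B' → A'.card = m → B'.card = m →
      1024 * N * ((incPairs A' B').card + (incPairs B' A').card) ≤ m ^ 2 →
      ∃ F : Finset (Pt × Pt), F.card = K ∧ (∀ e ∈ F, e.1 ∈ A' ∧ e.2 ∈ B') ∧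
          ∀ e ∈ F, ∀ f ∈ F, e ≠ f → SegCross e f) :
    ∃ F : Finset (Pt × Pt), F.card = N * K ∧ (∀ e ∈ F, e.1 ∈ A ∧ e.2 ∈ B) ∧
          ∀ e ∈ F, ∀ f ∈ F, e ≠ f → SegCross e f := by
  have hAne : A.Nonempty := Finset.card_pos.1 (by rw [hA]; positivity)
  have hBne : B.Nonempty := Finset.card_pos.1 (by rw [hB]; positivity)
  obtain ⟨C, hC⟩ := geoBlocks h hBne N m hm hA (by omega)
  obtain ⟨D, hD⟩ := geoBlocks h.symm hAne N m hm hB (by omega)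
  set Q := Finset.range (5 * N) ×ˢ Finset.range (5 * N) with hQ
  have s1 := sum_incPairs h hBne (5 * N) C D (fun i hi => (hC i hi).1) (fun i hi => (hD i hi).1)
    (fun i hi => (hC i hi).2.2) (fun i hi => (hD i hi).2.2)
  have s2 := sum_incPairs h.symm hAne (5 * N) D C (fun i hi => (hD i hi).1)
    (fun i hi => (hC i hi).1) (fun i hi => (hD i hi).2.2) (fun i hi => (hC i hi).2.2)
  rw [Finset.sum_product_right] at s2
  rw [← Finset.sum_product'
    (f := fun x y => (incPairs (D y) (C x)).card)] at s2
  set w : ℕ × ℕ → ℕ := fun z => (incPairs (C z.1) (D z.2)).card + (incPairs (D z.2) (C z.1)).card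
    with hw
  have s3 : ∑ z ∈ Q, w z ≤ (incPairs A B).card + (incPairs B A).card := by
    rw [hw, Finset.sum_add_distrib]
    exact add_le_add s1 s2
  set G := Q.filter fun z => 1024 * N * w z ≤ m ^ 2 with hG
  set Bd := Q.filter fun z => ¬ 1024 * N * w z ≤ m ^ 2 with hBd
  have hGB : G.card + Bd.card = 25 * N ^ 2 := by
    rw [Finset.card_filter_add_card_filter_not, hQ, Finset.card_product, Finset.card_range]; ring
  have hbd : Bd.card * m ^ 2 ≤ 1024 * N * ((incPairs A B).card + (incPairs B A).card) := by
    calc Bd.card * m ^ 2 ≤ ∑ z ∈ Bd, 1024 * N * w z := by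
          rw [← smul_eq_mul]
          refine Finset.card_nsmul_le_sum _ _ _ fun x hx => ?_
          have := (Finset.mem_filter.1 hx).2
          omega
      _ ≤ ∑ z ∈ Q, 1024 * N * w z :=
          Finset.sum_le_sum_of_subset (Finset.filter_subset _ _)
      _ = 1024 * N * ∑ z ∈ Q, w z := by rw [Finset.mul_sum]
      _ ≤ _ := Nat.mul_le_mul_left _ s3
  have hbd2 : 8 * Bd.card ≤ 81 * N ^ 2 := by
    have : 8 * Bd.card * m ^ 2 ≤ 81 * N ^ 2 * m ^ 2 := by
      calc 8 * Bd.card * m ^ 2 ≤ N * (8192 * ((incPairs A B).card + (incPairs B A).card)) := by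
            linarith
        _ ≤ N * (81 * N * m ^ 2) := Nat.mul_le_mul_left _ hJ
        _ = _ := by ring
    exact Nat.le_of_mul_le_mul_right this (by positivity)
  obtain ⟨t, -, ht⟩ := Finset.exists_lt_card_fiber_of_mul_lt_card_of_maps_to
    (s := G) (t := Finset.range (10 * N)) (f := fun z => z.1 + 5 * N - z.2) (n := N - 1) (by
      intro z hz
      have := (Finset.mem_filter.1 hz).1
      simp only [hQ, Finset.mem_product, Finset.mem_range] at this ⊢
      omega) (by
      rw [Finset.card_range]
      obtain ⟨n, rfl⟩ : ∃ n, N = n + 1 := ⟨N - 1, by omega⟩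
      simp only [Nat.add_sub_cancel]
      nlinarith)
  obtain ⟨S, hS, hScard⟩ := Finset.exists_subset_card_eq
    (show N ≤ (G.filter fun z => z.1 + 5 * N - z.2 = t).card by omega)
  have hSp : ∀ z ∈ S, z.1 < 5 * N ∧ z.2 < 5 * N ∧ 1024 * N * w z ≤ m ^ 2 ∧
      z.1 + 5 * N - z.2 = t := by
    intro z hz
    have := hS hz
    simp only [hG, hQ, Finset.mem_filter, Finset.mem_product, Finset.mem_range] at this
    tauto
  have hF : ∀ z : ℕ × ℕ, ∃ F : Finset (Pt × Pt), z ∈ S → (F.card = K ∧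
      (∀ e ∈ F, e.1 ∈ C z.1 ∧ e.2 ∈ D z.2) ∧
          ∀ e ∈ F, ∀ f ∈ F, e ≠ f → SegCross e f) := by
    intro z
    by_cases hz : z ∈ S
    · obtain ⟨z1, z2, z3, -⟩ := hSp z hz
      obtain ⟨F, hF⟩ := ih (C z.1) (D z.2) (h.mono (hC _ z1).1 (hD _ z2).1) (hC _ z1).2.1
        (hD _ z2).2.1 z3
      exact ⟨F, fun _ => hF⟩
    · exact ⟨∅, fun k => absurd k hz⟩
  choose F hF using hF
  have hord : ∀ z ∈ S, ∀ z' ∈ S, z ≠ z' → (z.1 < z'.1 ∧ z.2 < z'.2) ∨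
      (z'.1 < z.1 ∧ z'.2 < z.2) := by
    intro z hz z' hz' hne
    obtain ⟨a1, a2, -, a3⟩ := hSp z hz
    obtain ⟨b1, b2, -, b3⟩ := hSp z' hz'
    have : ¬ (z.1 = z'.1 ∧ z.2 = z'.2) := fun k => hne (Prod.ext k.1 k.2)
    omega
  have hcr : ∀ z ∈ S, ∀ z' ∈ S, (z.1 < z'.1 ∧ z.2 < z'.2) → ∀ e ∈ F z, ∀ f ∈ F z',
      SegCross e f := by
    intro z hz z' hz' hlt e he f hf
    obtain ⟨e1, e2⟩ := (hF z hz).2.1 e he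
    obtain ⟨f1, f2⟩ := (hF z' hz').2.1 f hf
    obtain ⟨a1, a2, -, -⟩ := hSp z hz
    obtain ⟨b1, b2, -, -⟩ := hSp z' hz'
    have l1 := (hC z.1 a1).2.2 z'.1 b1 hlt.1 e.1 e1 f.1 f1
    have l2 := (hD z.2 a2).2.2 z'.2 b2 hlt.2 e.2 e2 f.2 f2
    exact cross_of (l1.2 _ ((hD _ a2).1 e2)) (l1.2 _ ((hD _ b2).1 f2))
      (l2.2 _ ((hC _ a1).1 e1)) (l2.2 _ ((hC _ b1).1 f1))
  refine ⟨S.biUnion F, ?_, ?_, ?_⟩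
  · rw [Finset.card_biUnion, Finset.sum_congr rfl (fun z hz => (hF z hz).1), Finset.sum_const,
      hScard, smul_eq_mul]
    intro z hz z' hz' hne
    rw [Function.onFun, Finset.disjoint_left]
    intro e he he'
    obtain ⟨e1, e2⟩ := (hF z hz).2.1 e he
    obtain ⟨f1, f2⟩ := (hF z' hz').2.1 e he'
    obtain ⟨a1, a2, -, -⟩ := hSp z hz
    obtain ⟨b1, b2, -, -⟩ := hSp z' hz'
    rcases hord z hz z' hz' hne with k | k
    · exact ((hC z.1 a1).2.2 z'.1 b1 k.1 e.1 e1 e.1 f1).1 rfl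
    · exact ((hC z'.1 b1).2.2 z.1 a1 k.1 e.1 f1 e.1 e1).1 rfl
  · intro e he
    obtain ⟨z, hz, he⟩ := Finset.mem_biUnion.1 he
    obtain ⟨a1, a2, -, -⟩ := hSp z hz
    exact ⟨(hC _ a1).1 ((hF z hz).2.1 e he).1, (hD _ a2).1 ((hF z hz).2.1 e he).2⟩
  · intro e he f hf hef
    obtain ⟨z, hz, he⟩ := Finset.mem_biUnion.1 he
    obtain ⟨z', hz', hf⟩ := Finset.mem_biUnion.1 hf
    by_cases hzz : z = z'
    · subst hzz
      exact (hF z hz).2.2 e he f hf hef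
    · rcases hord z hz z' hz' hzz with k | k
      · exact hcr z hz z' hz' k e he f hf
      · exact (hcr z' hz' z hz k f hf e he).symm

theorem tri (t : ℕ) : (t + 2) * (t + 1) / 2 = (t + 1) + (t + 1) * t / 2 := by
  rw [show (t + 2) * (t + 1) = (t + 1) * t + 2 * (t + 1) by ring,
    Nat.add_mul_div_left _ _ (by norm_num)]
  ring

theorem mainInd (t : ℕ) : ∀ A B : Finset Pt, Cfg A B →
    A.card = 9 ^ (t + 1) * 8 ^ ((t + 1) * t / 2) →
    B.card = 9 ^ (t + 1) * 8 ^ ((t + 1) * t / 2) →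
    1024 * 8 ^ (t + 1) * ((incPairs A B).card + (incPairs B A).card) ≤
      (9 ^ (t + 1) * 8 ^ ((t + 1) * t / 2)) ^ 2 →
    ∃ F : Finset (Pt × Pt), F.card = 8 ^ ((t + 1) * t / 2) ∧
      (∀ e ∈ F, e.1 ∈ A ∧ e.2 ∈ B) ∧ ∀ e ∈ F, ∀ f ∈ F, e ≠ f → SegCross e f := by
  induction t with
  | zero =>
    intro A B _ hA hB _
    obtain ⟨a, ha⟩ : A.Nonempty := Finset.card_pos.1 (by rw [hA]; positivity)
    obtain ⟨b, hb⟩ : B.Nonempty := Finset.card_pos.1 (by rw [hB]; positivity)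
    refine ⟨{(a, b)}, by simp, by simp [ha, hb], ?_⟩
    intro e he f hf hef
    rw [Finset.mem_singleton] at he hf
    exact absurd (he.trans hf.symm) hef
  | succ t ih =>
    intro A B h hA hB hJ
    rw [show t + 1 + 1 = t + 2 by ring, tri] at *
    set m := 9 ^ (t + 1) * 8 ^ ((t + 1) * t / 2) with hm
    set N := 8 ^ (t + 1) with hN
    have hN0 : 0 < N := by positivity
    have hm0 : 0 < m := by positivity
    have e : 9 ^ (t + 2) * 8 ^ (t + 1 + (t + 1) * t / 2) = 9 * N * m := by
      rw [hN, hm]; ring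
    rw [e] at hA hB hJ
    have := step h N m _ hN0 hm0 hA hB (by
      have e2 : 8 ^ (t + 2) = 8 * N := by rw [hN]; ring
      rw [e2] at hJ
      refine le_of_mul_le_mul_left (a := N) ?_ hN0
      calc _ = 1024 * (8 * N) * ((incPairs A B).card + (incPairs B A).card) := by ring
        _ ≤ _ := hJ
        _ = _ := by ring) ih
    rw [pow_add]
    exact this

theorem collinear_of_orn {x y b : Pt} (hxy : x ≠ y) (h : orn x y b = 0) :
    Collinear ℝ ({x, y, b} : Set Pt) := by
  rw [collinear_iff_of_mem (p₀ := x) (by simp)]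
  refine ⟨y - x, ?_⟩
  intro p hp
  simp only [Set.mem_insert_iff, Set.mem_singleton_iff] at hp
  rcases hp with rfl | rfl | rfl
  · exact ⟨0, by simp⟩
  · exact ⟨1, by simp⟩
  · unfold orn at h
    by_cases h1 : p.1 = p.1 ∧ y.1 - x.1 = 0
    · have h2 : y.2 - x.2 ≠ 0 := fun k => hxy (Prod.ext (by linarith) (by linarith))
      have h3 : p.1 = x.1 := by
        rw [h1.2] at h
        have : (y.2 - x.2) * (p.1 - x.1) = 0 := by linarith
        rcases mul_eq_zero.1 this with k | k
        · exact absurd k h2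
        · linarith
      refine ⟨(p.2 - x.2) / (y.2 - x.2), Prod.ext ?_ ?_⟩
      · simp [h1.2, h3]
      · simp [h2]
    · have h2 : y.1 - x.1 ≠ 0 := fun k => h1 ⟨rfl, k⟩
      refine ⟨(p.1 - x.1) / (y.1 - x.1), Prod.ext ?_ ?_⟩
      · simp [h2]
      · simp only [vadd_eq_add, Prod.snd_add, Prod.smul_snd, Prod.snd_sub, smul_eq_mul]
        field_simp
        linarith

theorem cfg_of {A B : Finset Pt} (hs : Separated A B) (hg : GenPos (A ∪ B)) : Cfg A B := by
  have hd : ∀ a ∈ A, ∀ b ∈ B, a ≠ b := by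
    rintro a ha b hb rfl
    exact Set.disjoint_left.1 hs (subset_convexHull ℝ _ ha) (subset_convexHull ℝ _ hb)
  refine ⟨?_, ?_, ?_⟩
  · obtain ⟨f, u, v, h1, h2, h3⟩ := geometric_hahn_banach_compact_closed
      (convex_convexHull ℝ (B : Set Pt)) (B.finite_toSet.isCompact_convexHull (𝕜 := ℝ))
      (convex_convexHull ℝ (A : Set Pt)) (A.finite_toSet.isCompact_convexHull (𝕜 := ℝ)).isClosed hs.symm
    have hf : ∀ z : Pt, f z = f (1, 0) * z.1 + f (0, 1) * z.2 := by
      intro z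
      have : z = z.1 • ((1, 0) : Pt) + z.2 • ((0, 1) : Pt) := by ext <;> simp
      conv_lhs => rw [this]
      rw [map_add, map_smul, map_smul, smul_eq_mul, smul_eq_mul]; ring
    refine ⟨f (1, 0), f (0, 1), u, fun a ha => ?_, fun b hb => ?_⟩
    · rw [← hf]; linarith [h3 a (subset_convexHull ℝ _ ha)]
    · rw [← hf]; exact h1 b (subset_convexHull ℝ _ hb)
  · intro x hx y hy hxy b hb h0
    exact hg x (Finset.mem_union_left _ hx) y (Finset.mem_union_left _ hy) b
      (Finset.mem_union_right _ hb) hxy (hd x hx b hb) (hd y hy b hb) (collinear_of_orn hxy h0)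
  · intro x hx y hy hxy b hb h0
    exact hg x (Finset.mem_union_right _ hx) y (Finset.mem_union_right _ hy) b
      (Finset.mem_union_left _ hb) hxy (hd b hb x hx).symm (hd b hb y hy).symm
      (collinear_of_orn hxy h0)

/-- Let `s ≥ 1`, `K = 8^(s(s−1)/2)`, `M = 9^s·K`, `ε = 2^(−3s−11)`. If `A` and `B`
are separated `M`-element point sets forming an `ε`-avoiding pair and `A ∪ B` is in general
position, then there exist `K` pairwise crossing segments, each connecting a point of `A` to a
point of `B`. -/
theorem stmt7 :
    ∀ s : ℕ, 0 < s → ∀ K M : ℕ, K = 8 ^ (s * (s - 1) / 2) → M = 9 ^ s * K →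
      ∀ A B : Finset Pt, A.card = M → B.card = M → Separated A B →
        EpsAvoiding ((2 : ℝ) ^ (-(3 * (s : ℤ) + 11))) M A B →
        GenPos (A ∪ B) →
        ∃ F : Finset (Pt × Pt), F.card = K ∧ (∀ e ∈ F, e.1 ∈ A ∧ e.2 ∈ B) ∧
          ∀ e ∈ F, ∀ f ∈ F, e ≠ f → SegCross e f := by
  intro s hs K M hK hM A B hA hB hsep heps hg
  obtain ⟨t, rfl⟩ : ∃ t, s = t + 1 := ⟨s - 1, by omega⟩
  simp only [Nat.add_sub_cancel] at hK
  subst hK hM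
  refine mainInd t A B (cfg_of hsep hg) hA hB ?_
  have i1 := incPairs_le A B
  have i2 := incPairs_le B A
  unfold EpsAvoiding at heps
  set M := 9 ^ (t + 1) * 8 ^ ((t + 1) * t / 2) with hMdef
  have h2 : (2 : ℝ) ^ (-(3 * ((t + 1 : ℕ) : ℤ) + 11)) * (2048 * 8 ^ (t + 1)) = 1 := by
    rw [show (2048 * 8 ^ (t + 1) : ℝ) = (2 : ℝ) ^ (3 * ((t + 1 : ℕ) : ℤ) + 11) by
      rw [zpow_add₀ (by norm_num), zpow_mul, zpow_natCast]; norm_num; ring,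
      ← zpow_add₀ (by norm_num)]
    simp
  have h3 : (2048 * 8 ^ (t + 1) : ℝ) * ((iota A B : ℝ) + (iota B A : ℝ)) ≤ (M : ℝ) ^ 2 := by
    calc _ ≤ (2048 * 8 ^ (t + 1) : ℝ) * (_ * (M : ℝ) ^ 2) :=
          mul_le_mul_of_nonneg_left heps (by positivity)
      _ = (M : ℝ) ^ 2 := by linear_combination (M : ℝ) ^ 2 * h2
  have h4 : 2048 * 8 ^ (t + 1) * (iota A B + iota B A) ≤ M ^ 2 := by exact_mod_cast h3
  calc _ ≤ 1024 * 8 ^ (t + 1) * (2 * iota A B + 2 * iota B A) :=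
        Nat.mul_le_mul_left _ (add_le_add i1 i2)
    _ = 2048 * 8 ^ (t + 1) * (iota A B + iota B A) := by ring
    _ ≤ _ := h4
end
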